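/- Let V = ℂ² with standard basis (v₁, v₂) and let c : V ⊗ V → V ⊗ V be the ℂ-linear map defined by c(v₁⊗v₁) = ξ^{-ij} v₁⊗v₁, c(v₁⊗v₂) = ξ^{-j(i+1)} v₂⊗v₁ + (ξ^{-ij} + ξ^{(i+1)(p-j)}) v₁⊗v₂, c(v₂⊗v₁) = (-1)^i ξ^{-ij} v₁⊗v₂, and c(v₂⊗v₂) = ξ^{(i+1)(p-j)} v₂⊗v₂ + θ^{-2}·ξ^{-(i+1)(2+j)}·(1 + ξ^{pi+j}) v₁⊗v₁. Then c satisfies the braid equation (c⊗id_V)∘(id_V⊗c)∘(c⊗id_V) = (id_V⊗c)∘(c⊗id_V)∘(id_V⊗c) on V ⊗ V ⊗ V. -/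

import Mathlib

open scoped TensorProduct

noncomputable section

/-- The underlying 2-dimensional space of the braided vector space `V_{i,j}`. -/
abbrev VC : Type := Fin 2 → ℂ

/-- The first standard basis vector `v₁` of `ℂ²`. -/
def e1 : VC := ![1, 0]

/-- The second standard basis vector `v₂` of `ℂ²`. -/
def e2 : VC := ![0, 1]

/-- `c ⊗ id` on `(V ⊗ V) ⊗ V`. -/
def braidL (c : (VC ⊗[ℂ] VC) →ₗ[ℂ] (VC ⊗[ℂ] VC)) :
    ((VC ⊗[ℂ] VC) ⊗[ℂ] VC) →ₗ[ℂ] ((VC ⊗[ℂ] VC) ⊗[ℂ] VC) :=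
  TensorProduct.map c (LinearMap.id : VC →ₗ[ℂ] VC)

/-- `id ⊗ c` on `(V ⊗ V) ⊗ V`, transported through the associator. -/
def braidR (c : (VC ⊗[ℂ] VC) →ₗ[ℂ] (VC ⊗[ℂ] VC)) :
    ((VC ⊗[ℂ] VC) ⊗[ℂ] VC) →ₗ[ℂ] ((VC ⊗[ℂ] VC) ⊗[ℂ] VC) :=
  (TensorProduct.assoc ℂ VC VC VC).symm.toLinearMap ∘ₗ
    TensorProduct.map (LinearMap.id : VC →ₗ[ℂ] VC) c ∘ₗ
      (TensorProduct.assoc ℂ VC VC VC).toLinearMap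

/-- The standard basis of `ℂ²`. -/
def stdBasis : Module.Basis (Fin 2) ℂ VC := Pi.basisFun ℂ (Fin 2)

theorem stdBasis_zero : stdBasis 0 = e1 := by
  ext n; fin_cases n <;> simp [stdBasis, e1]

theorem stdBasis_one : stdBasis 1 = e2 := by
  ext n; fin_cases n <;> simp [stdBasis, e2]

/-- A linear endomorphism of `V ⊗ V` can be prescribed on the standard basis. -/
theorem exists_linearMap_apply_basis (w11 w12 w21 w22 : VC ⊗[ℂ] VC) :
    ∃ c : (VC ⊗[ℂ] VC) →ₗ[ℂ] (VC ⊗[ℂ] VC), c (e1 ⊗ₜ[ℂ] e1) = w11 ∧ c (e1 ⊗ₜ[ℂ] e2) = w12 ∧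
      c (e2 ⊗ₜ[ℂ] e1) = w21 ∧ c (e2 ⊗ₜ[ℂ] e2) = w22 := by
  let B := stdBasis.tensorProduct stdBasis
  let c := B.constr ℂ fun n ↦ ![![w11, w12], ![w21, w22]] n.1 n.2
  have h (m n : Fin 2) : c (stdBasis m ⊗ₜ stdBasis n) = ![![w11, w12], ![w21, w22]] m n := by
    rw [← Module.Basis.tensorProduct_apply, Module.Basis.constr_basis]
  refine ⟨c, ?_, ?_, ?_, ?_⟩
  · simpa [stdBasis_zero] using h 0 0
  · simpa [stdBasis_zero, stdBasis_one] using h 0 1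
  · simpa [stdBasis_zero, stdBasis_one] using h 1 0
  · simpa [stdBasis_one] using h 1 1

theorem IsPrimitiveRoot.pow_half_eq_neg_one {p : ℕ} (hp : 1 ≤ p) {ξ : ℂ}
    (hξ : IsPrimitiveRoot ξ (2 * p)) : ξ ^ p = -1 :=
  (hξ.pow (by omega) (mul_comm 2 p)).eq_neg_one_of_two_right

theorem zpow_succ_mul_sub {p : ℕ} {ξ : ℂ} (hξ : ξ ≠ 0) (h : ξ ^ p = -1) (i j : ℕ) :
    ξ ^ (((i : ℤ) + 1) * ((p : ℤ) - (j : ℤ))) = -(-1) ^ i * (ξ ^ (j * (i + 1)))⁻¹ := by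
  have e : ((i : ℤ) + 1) * ((p : ℤ) - (j : ℤ)) =
      ((p * (i + 1) : ℕ) : ℤ) - ((j * (i + 1) : ℕ) : ℤ) := by
    push_cast; ring
  rw [e, zpow_sub₀ hξ, zpow_natCast, zpow_natCast, pow_mul ξ p, h, pow_succ]
  ring

/-- Braidings of this eight-vertex shape satisfy the braid equation. -/
theorem braid_equation_of_apply_basis (c : (VC ⊗[ℂ] VC) →ₗ[ℂ] (VC ⊗[ℂ] VC)) (a b k s : ℂ)
    (hs : s = 1 ∨ s = -1)
    (h11 : c (e1 ⊗ₜ[ℂ] e1) = a • (e1 ⊗ₜ[ℂ] e1))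
    (h12 : c (e1 ⊗ₜ[ℂ] e2) = b • (e2 ⊗ₜ[ℂ] e1) + (a + -s * b) • (e1 ⊗ₜ[ℂ] e2))
    (h21 : c (e2 ⊗ₜ[ℂ] e1) = (s * a) • (e1 ⊗ₜ[ℂ] e2))
    (h22 : c (e2 ⊗ₜ[ℂ] e2) = (-s * b) • (e2 ⊗ₜ[ℂ] e2) + k • (e1 ⊗ₜ[ℂ] e1)) :
    (braidL c) ∘ₗ (braidR c) ∘ₗ (braidL c) = (braidR c) ∘ₗ (braidL c) ∘ₗ (braidR c) := by
  have hL (x y z : VC) : braidL c ((x ⊗ₜ y) ⊗ₜ z) = c (x ⊗ₜ y) ⊗ₜ z := rfl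
  have hR (x y z : VC) : braidR c ((x ⊗ₜ y) ⊗ₜ z) =
      (TensorProduct.assoc ℂ VC VC VC).symm (x ⊗ₜ c (y ⊗ₜ z)) := rfl
  apply ((stdBasis.tensorProduct stdBasis).tensorProduct stdBasis).ext
  rintro ⟨⟨x, y⟩, z⟩
  simp only [Module.Basis.tensorProduct_apply, LinearMap.comp_apply]
  rcases hs with rfl | rfl <;> fin_cases x <;> fin_cases y <;> fin_cases z <;>
    simp only [Fin.zero_eta, Fin.mk_one, stdBasis_zero, stdBasis_one, hL, hR, h11, h12, h21, h22,
      map_add, map_smul, TensorProduct.tmul_add, TensorProduct.add_tmul, TensorProduct.tmul_smul,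
      ← TensorProduct.smul_tmul', TensorProduct.assoc_symm_tmul] <;>
    module

/-- the braiding of the Yetter–Drinfeld module `V_{i,j}`, given by the
prescribed formulas on the basis `v₁, v₂` of `ℂ²`, satisfies the braid equation. -/
theorem statement11 (p : ℕ) (hp : 1 ≤ p) (ξ θ : ℂ) (hξ : IsPrimitiveRoot ξ (2 * p))
    (hθ : θ ^ 2 = (1 - (ξ ^ 2)⁻¹) * ((ξ - 1) / (ξ + 1)))
    (i j : ℕ) (hi : i < 2 * p) (hj : j < 2 * p)
    (hΛ : ¬ ((2 * p : ℤ) ∣ ((p : ℤ) * (i : ℤ) - (j : ℤ)))) :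
    ∃ c : (VC ⊗[ℂ] VC) →ₗ[ℂ] (VC ⊗[ℂ] VC),
      c (e1 ⊗ₜ[ℂ] e1) = (ξ ^ (i * j))⁻¹ • (e1 ⊗ₜ[ℂ] e1) ∧
      c (e1 ⊗ₜ[ℂ] e2) = (ξ ^ (j * (i + 1)))⁻¹ • (e2 ⊗ₜ[ℂ] e1) +
        ((ξ ^ (i * j))⁻¹ + ξ ^ (((i : ℤ) + 1) * ((p : ℤ) - (j : ℤ)))) • (e1 ⊗ₜ[ℂ] e2) ∧
      c (e2 ⊗ₜ[ℂ] e1) = ((-1 : ℂ) ^ i * (ξ ^ (i * j))⁻¹) • (e1 ⊗ₜ[ℂ] e2) ∧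
      c (e2 ⊗ₜ[ℂ] e2) = ξ ^ (((i : ℤ) + 1) * ((p : ℤ) - (j : ℤ))) • (e2 ⊗ₜ[ℂ] e2) +
        ((θ ^ 2)⁻¹ * (ξ ^ ((i + 1) * (2 + j)))⁻¹ * (1 + ξ ^ (p * i + j))) • (e1 ⊗ₜ[ℂ] e1) ∧
      (braidL c) ∘ₗ (braidR c) ∘ₗ (braidL c) = (braidR c) ∘ₗ (braidL c) ∘ₗ (braidR c) := by
  obtain ⟨c, h11, h12, h21, h22⟩ := exists_linearMap_apply_basis _ _ _ _
  refine ⟨c, h11, h12, h21, h22, ?_⟩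
  rw [zpow_succ_mul_sub (hξ.ne_zero (by omega)) (hξ.pow_half_eq_neg_one hp)] at h12 h22
  exact braid_equation_of_apply_basis c _ _ _ _ (neg_one_pow_eq_or ℂ i) h11 h12 h21 h22
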